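/- Suppose 0 < β < 1/(2N+1) and t > 0. Then Γ ∪ (Γ + t) is a self-similar set if and only if t = j(1-β)/N · β^{-k} for some j ∈ {1, 2, …, ⌊(N+1)/2⌋} and some integer k ≥ 1. -/

import Mathlib

noncomputable section

namespace HSCantor

/-- A `D`-coding of `x`: a digit sequence `c` with digits in `D ⊆ ℤ` such that
`x = (1-β)/N · Σ_{k=1}^∞ c_k β^{k-1}` (here indexed from `k = 0`). -/
def IsCoding (N : ℕ) (β : ℝ) (D : Set ℤ) (x : ℝ) (c : ℕ → ℤ) : Prop :=
  (∀ k, c k ∈ D) ∧ x = (1 - β) / N * ∑' k : ℕ, (c k : ℝ) * β ^ k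

/-- The set `Γ_{β,D}` for a digit set `D ⊆ ℤ`. -/
def cantorD (N : ℕ) (β : ℝ) (D : Set ℤ) : Set ℝ := { x | ∃ c, IsCoding N β D x c }

/-- The homogeneous symmetric Cantor set `Γ = Γ_{β,{0,1,…,N}}`. -/
def Gamma (N : ℕ) (β : ℝ) : Set ℝ := cantorD N β (Set.Icc 0 (N : ℤ))

/-- `E ⊆ ℝ` is a self-similar set: it is nonempty, compact, and is the union of its
images under finitely many contracting similitudes `x ↦ r x + b`, `0 < |r| < 1`. -/
def IsSelfSimilar (E : Set ℝ) : Prop :=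
  E.Nonempty ∧ IsCompact E ∧ ∃ F : Finset (ℝ × ℝ),
    (∀ p ∈ F, 0 < |p.1| ∧ |p.1| < 1) ∧
    E = ⋃ p ∈ F, (fun x => p.1 * x + p.2) '' E

/-- `Γ_t = ⋃_{j=0}^m (Γ + t_j)`. -/
def GammaT (N : ℕ) (β : ℝ) {m : ℕ} (t : Fin (m + 1) → ℝ) : Set ℝ :=
  ⋃ j, (fun x => x + t j) '' Gamma N β

/-- The set `T = ⋃_{n≥1} { (1-β)/N · Σ_{k=1}^n j_k β^{-k} : j_k ∈ {0,…,N} }`. -/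
def Tset (N : ℕ) (β : ℝ) : Set ℝ :=
  { x | ∃ n : ℕ, 1 ≤ n ∧ ∃ c : ℕ → ℕ, (∀ k, c k ≤ N) ∧
      x = (1 - β) / N * ∑ k ∈ Finset.Icc 1 n, (c k : ℝ) * β ^ (-(k : ℤ)) }

/-- `d` is a digit representation of the translation vector `t` with `τ` digits:
`t_j = (1-β)/N · Σ_{k=1}^τ d_{j,k} β^{-k}` with all digits in `{0,…,N}`. -/
def IsDigitRep (N : ℕ) (β : ℝ) {m : ℕ} (t : Fin (m + 1) → ℝ) (τ : ℕ)
    (d : Fin (m + 1) → ℕ → ℕ) : Prop :=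
  (∀ j k, d j k ≤ N) ∧
    ∀ j, t j = (1 - β) / N * ∑ k ∈ Finset.Icc 1 τ, (d j k : ℝ) * β ^ (-(k : ℤ))

/-- `d` is a digit representation of `t` with `τ = τ_t` digits, `τ_t` minimal. -/
def IsMinimalRep (N : ℕ) (β : ℝ) {m : ℕ} (t : Fin (m + 1) → ℝ) (τ : ℕ)
    (d : Fin (m + 1) → ℕ → ℕ) : Prop :=
  IsDigitRep N β t τ d ∧ ∀ τ' < τ, ∀ d', ¬ IsDigitRep N β t τ' d'

/-- `s_k = max_{0 ≤ j ≤ m} t_{j,k}`. -/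
def digitSup {m : ℕ} (d : Fin (m + 1) → ℕ → ℕ) (k : ℕ) : ℕ :=
  Finset.univ.sup fun j => d j k

/-- Words of length `n` over the alphabet `{0,1,…,N}`, as lists of naturals. -/
def Words (N n : ℕ) : Set (List ℕ) := { w | w.length = n ∧ ∀ x ∈ w, x ≤ N }

/-- `Ω_t^n`: words `i_1 … i_n ∈ {0,…,N}^n` with `i_{n+1-k} ≤ N - s_k` for `1 ≤ k ≤ τ`.
(A list `w = [i_1, …, i_n]` satisfies `i_{n+1-k} = w.getD (n-k) 0`.) -/
def Omega (N τ : ℕ) (s : ℕ → ℕ) (n : ℕ) : Set (List ℕ) :=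
  { w | w ∈ Words N n ∧ ∀ k, 1 ≤ k → k ≤ τ → w.getD (n - k) 0 + s k ≤ N }

/-- `Ω̂_t^n`: words `i_1 … i_n ∈ {0,…,N}^n` with `i_{n+1-k} ≥ s_k` for `1 ≤ k ≤ τ`. -/
def OmegaHat (N τ : ℕ) (s : ℕ → ℕ) (n : ℕ) : Set (List ℕ) :=
  { w | w ∈ Words N n ∧ ∀ k, 1 ≤ k → k ≤ τ → s k ≤ w.getD (n - k) 0 }

/-- `W_t^τ = A_t^τ ∪ Â_t^τ`: words obtained from a word in `Ω_t^τ` (resp. `Ω̂_t^τ`)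
by adding (resp. subtracting) the digits of some `t_j` to the last `τ` positions. -/
def Wset (N : ℕ) {m : ℕ} (τ : ℕ) (d : Fin (m + 1) → ℕ → ℕ) : Set (List ℕ) :=
  { v | ∃ w ∈ Omega N τ (digitSup d) τ, ∃ j : Fin (m + 1),
      v = List.ofFn fun idx : Fin τ => w.getD idx 0 + d j (τ - (idx : ℕ)) } ∪
  { v | ∃ w ∈ OmegaHat N τ (digitSup d) τ, ∃ j : Fin (m + 1),
      v = List.ofFn fun idx : Fin τ => w.getD idx 0 - d j (τ - (idx : ℕ)) }

/-- The symbolic admissibility condition: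
`⋃_{n=τ}^ℓ {0,…,N}^{n-τ} × W_t^τ × {0,…,N}^{ℓ-n} = {0,…,N}^ℓ` for some `ℓ ≥ τ`. -/
def AdmissibleWith (N : ℕ) {m : ℕ} (τ : ℕ) (d : Fin (m + 1) → ℕ → ℕ) : Prop :=
  ∃ ℓ, τ ≤ ℓ ∧
    (⋃ n ∈ Finset.Icc τ ℓ,
      { z : List ℕ | ∃ u ∈ Words N (n - τ), ∃ w ∈ Wset N τ d, ∃ v ∈ Words N (ℓ - n),
          z = u ++ w ++ v }) = Words N ℓ

/-- `t` is an admissible translation vector. -/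
def IsAdmissible (N : ℕ) (β : ℝ) {m : ℕ} (t : Fin (m + 1) → ℝ) : Prop :=
  (∀ j, t j ∈ Tset N β) ∧
    ∃ τ d, IsMinimalRep N β t τ d ∧ AdmissibleWith N τ d

/-- The vertex set `V_t = {0,…,N}^τ \ W_t^τ` of the directed graph `G_t`. -/
def Vset (N : ℕ) {m : ℕ} (τ : ℕ) (d : Fin (m + 1) → ℕ → ℕ) : Set (List ℕ) :=
  Words N τ \ Wset N τ d

/-- The graph on `V` with an edge `i → j` iff `i_2 … i_τ = j_1 … j_{τ-1}` has a cycle: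
a directed path of positive length starting and ending at the same vertex. -/
def HasCycle (V : Set (List ℕ)) : Prop :=
  ∃ (L : ℕ) (p : ℕ → List ℕ), 0 < L ∧ (∀ i ≤ L, p i ∈ V) ∧
    (∀ i < L, (p i).drop 1 = (p (i + 1)).dropLast) ∧ p 0 = p L

open Classical in
/-- The adjacency matrix of the directed graph `G_t`, indexed by all words of length `τ`
over `{0,…,N}`; its `(i,j)` entry is `1` exactly when `i, j ∈ V_t` and there is a
directed edge `i → j`, and the rows and columns outside `V_t` are zero. -/
def adjMat (N τ : ℕ) (V : Set (List ℕ)) :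
    Matrix (Fin τ → Fin (N + 1)) (Fin τ → Fin (N + 1)) ℕ :=
  fun i j =>
    if (List.ofFn fun k => (i k : ℕ)) ∈ V ∧ (List.ofFn fun k => (j k : ℕ)) ∈ V ∧
        (List.ofFn fun k => (i k : ℕ)).drop 1 = (List.ofFn fun k => (j k : ℕ)).dropLast
    then 1 else 0

/-- `φ_i(x) = βx + i(1-β)/N`. -/
def phi (N : ℕ) (β : ℝ) (i : ℕ) (x : ℝ) : ℝ := β * x + i * (1 - β) / N

/-- `φ_{i_1 … i_n} = φ_{i_1} ∘ ⋯ ∘ φ_{i_n}`. -/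
def phiWord (N : ℕ) (β : ℝ) (w : List ℕ) (x : ℝ) : ℝ := w.foldr (phi N β) x

/-- The conjugate translation vector `t̂_j = t_m - t_{m-j}`. -/
def conj {m : ℕ} (t : Fin (m + 1) → ℝ) : Fin (m + 1) → ℝ :=
  fun j => t (Fin.last m) - t ⟨m - (j : ℕ), Nat.lt_succ_of_le (Nat.sub_le m j)⟩

/-- The sum `Σ_{k ≥ 0} c_k β^k` of a digit sequence. -/
def digitSum (β : ℝ) (c : ℕ → ℤ) : ℝ := ∑' k : ℕ, (c k : ℝ) * β ^ k

/-- The sequence `c` preceded by `k` zeros. -/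
def shift (k : ℕ) (c : ℕ → ℤ) : ℕ → ℤ := fun n => if k ≤ n then c (n - k) else 0

/-- The sequence `c` preceded by the digit `i`. -/
def prepend (i : ℤ) (c : ℕ → ℤ) : ℕ → ℤ
  | 0 => i
  | n + 1 => c n

/-- A sequence with digits in `{0,…,N}`. -/
def IsDigitSeq (N : ℕ) (c : ℕ → ℤ) : Prop := ∀ k, c k ∈ Set.Icc 0 (N : ℤ)

section DigitSum

variable {N : ℕ} {β : ℝ}

lemma mem_Gamma_iff {x : ℝ} :
    x ∈ Gamma N β ↔ ∃ c, IsDigitSeq N c ∧ x = (1 - β) / N * digitSum β c := Iff.rfl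

lemma IsDigitSeq.abs_digit_le {c : ℕ → ℤ} (hc : IsDigitSeq N c) (k : ℕ) : |c k| ≤ (N : ℤ) := by
  have := hc k
  rw [Set.mem_Icc] at this
  exact abs_le.2 ⟨by omega, this.2⟩

lemma IsDigitSeq.shift {c : ℕ → ℤ} (hc : IsDigitSeq N c) (k : ℕ) :
    IsDigitSeq N (shift k c) := by
  intro n
  unfold HSCantor.shift
  split_ifs
  · exact hc _
  · simp

lemma summable_digits (h0 : 0 < β) (h1 : β < 1) {M : ℤ} {c : ℕ → ℤ} (hc : ∀ k, |c k| ≤ M) :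
    Summable fun k : ℕ => (c k : ℝ) * β ^ k := by
  refine Summable.of_norm_bounded (g := fun k => (M : ℝ) * β ^ k)
    ((summable_geometric_of_lt_one h0.le h1).mul_left _) fun k => ?_
  rw [norm_mul, Real.norm_eq_abs, Real.norm_eq_abs, abs_of_pos (pow_pos h0 k)]
  gcongr
  exact_mod_cast hc k

lemma abs_digitSum_le (h0 : 0 < β) (h1 : β < 1) {M : ℤ} {c : ℕ → ℤ} (hc : ∀ k, |c k| ≤ M) :
    |digitSum β c| ≤ M / (1 - β) := by
  have hg : HasSum (fun k => (M : ℝ) * β ^ k) (M / (1 - β)) := by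
    rw [div_eq_mul_inv]
    exact (hasSum_geometric_of_lt_one h0.le h1).mul_left _
  refine tsum_of_norm_bounded (f := fun k => (c k : ℝ) * β ^ k) hg fun k => ?_
  rw [norm_mul, Real.norm_eq_abs, Real.norm_eq_abs, abs_of_pos (pow_pos h0 k)]
  gcongr
  exact_mod_cast hc k

lemma digitSum_eq_zero_add (h0 : 0 < β) (h1 : β < 1) {M : ℤ} {c : ℕ → ℤ}
    (hc : ∀ k, |c k| ≤ M) :
    digitSum β c = c 0 + β * digitSum β fun n => c (n + 1) := by
  unfold digitSum
  rw [(summable_digits h0 h1 hc).tsum_eq_zero_add, ← tsum_mul_left]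
  simp only [pow_zero, mul_one, pow_succ]
  congr 1
  exact tsum_congr fun k => by ring

lemma IsDigitSeq.prepend {i : ℤ} (hi : i ∈ Set.Icc 0 (N : ℤ)) {c : ℕ → ℤ}
    (hc : IsDigitSeq N c) : IsDigitSeq N (prepend i c)
  | 0 => hi
  | n + 1 => hc n

lemma digitSum_prepend (h0 : 0 < β) (h1 : β < 1) {i : ℤ} (hi : i ∈ Set.Icc 0 (N : ℤ))
    {c : ℕ → ℤ} (hc : IsDigitSeq N c) :
    digitSum β (prepend i c) = i + β * digitSum β c :=
  digitSum_eq_zero_add h0 h1 (hc.prepend hi).abs_digit_le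

lemma digitSum_add (h0 : 0 < β) (h1 : β < 1) {M M' : ℤ} {c d : ℕ → ℤ}
    (hc : ∀ k, |c k| ≤ M) (hd : ∀ k, |d k| ≤ M') :
    digitSum β (fun n => c n + d n) = digitSum β c + digitSum β d := by
  unfold digitSum
  rw [← (summable_digits h0 h1 hc).tsum_add (summable_digits h0 h1 hd)]
  exact tsum_congr fun k => by push_cast; ring

lemma digitSum_sub (h0 : 0 < β) (h1 : β < 1) {M M' : ℤ} {c d : ℕ → ℤ}
    (hc : ∀ k, |c k| ≤ M) (hd : ∀ k, |d k| ≤ M') :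
    digitSum β (fun n => c n - d n) = digitSum β c - digitSum β d := by
  unfold digitSum
  rw [← (summable_digits h0 h1 hc).tsum_sub (summable_digits h0 h1 hd)]
  exact tsum_congr fun k => by push_cast; ring

lemma digitSum_single (p : ℕ) (j : ℤ) : digitSum β (Pi.single p j) = j * β ^ p := by
  unfold digitSum
  rw [tsum_eq_single p]
  · simp
  · intro b hb
    simp [hb]

lemma digitSum_const (h0 : 0 < β) (h1 : β < 1) (j : ℤ) :
    digitSum β (fun _ => j) = j / (1 - β) := by
  unfold digitSum
  rw [tsum_mul_left, tsum_geometric_of_lt_one h0.le h1, div_eq_mul_inv]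

lemma abs_shift_le {M : ℤ} {c : ℕ → ℤ} (hc : ∀ k, |c k| ≤ M) (k n : ℕ) :
    |shift k c n| ≤ M := by
  unfold shift
  split_ifs
  · exact hc _
  · simpa using (abs_nonneg _).trans (hc 0)

lemma digitSum_shift (h0 : 0 < β) (h1 : β < 1) {M : ℤ} {c : ℕ → ℤ} (hc : ∀ k, |c k| ≤ M)
    (k : ℕ) : digitSum β (shift k c) = β ^ k * digitSum β c := by
  induction k with
  | zero =>
    rw [show shift 0 c = c from funext fun n => by simp [shift], pow_zero, one_mul]
  | succ k ih =>
    rw [digitSum_eq_zero_add h0 h1 (abs_shift_le hc (k + 1))]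
    have : (fun n => shift (k + 1) c (n + 1)) = shift k c := by
      funext n
      simp [shift]
    rw [this, ih]
    simp only [shift, pow_succ]
    simp
    ring

lemma digit_zero_eq_zero (h0 : 0 < β) (h1 : β < 1) {M : ℤ} (hM : β * M < 1 - β)
    {e : ℕ → ℤ} (he : ∀ k, |e k| ≤ M) (h : digitSum β e = 0) : e 0 = 0 := by
  rw [digitSum_eq_zero_add h0 h1 he] at h
  have hb := abs_digitSum_le h0 h1 fun k => he (k + 1)
  have : |(e 0 : ℝ)| < 1 := by
    rw [eq_neg_of_add_eq_zero_left h, abs_neg, abs_mul, abs_of_pos h0]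
    calc _ ≤ β * (M / (1 - β)) := by gcongr
      _ < 1 := by rw [← mul_div_assoc, div_lt_one (by linarith)]; exact hM
  exact Int.abs_lt_one_iff.1 (by exact_mod_cast this)

/-- Expansions in powers of `β` with digits bounded by `M` are trivial when they vanish, provided
`β` is small compared with `M`. -/
lemma eq_zero_of_digitSum_eq_zero (h0 : 0 < β) (h1 : β < 1) {M : ℤ} (hM : β * M < 1 - β)
    {e : ℕ → ℤ} (he : ∀ k, |e k| ≤ M) (h : digitSum β e = 0) (n : ℕ) : e n = 0 := by
  induction n generalizing e with
  | zero => exact digit_zero_eq_zero h0 h1 hM he h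
  | succ n ih =>
    refine ih (e := fun n => e (n + 1)) (fun k => he (k + 1)) ?_
    have hz := digit_zero_eq_zero h0 h1 hM he h
    rw [digitSum_eq_zero_add h0 h1 he, hz] at h
    simpa [h0.ne'] using h

/-- Two sequences with digits in `{0,…,N}` and the same sum coincide. -/
lemma IsDigitSeq.ext_of_digitSum_eq (h0 : 0 < β) (h1 : β < 1) (hβ : β * N < 1 - β)
    {c d : ℕ → ℤ} (hc : IsDigitSeq N c) (hd : IsDigitSeq N d)
    (h : digitSum β c = digitSum β d) : c = d := by
  funext n
  refine sub_eq_zero.1 (eq_zero_of_digitSum_eq_zero h0 h1 (M := N) (by exact_mod_cast hβ)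
    (e := fun n => c n - d n) (fun k => ?_) ?_ n)
  · have := hc k
    have := hd k
    simp only [Set.mem_Icc] at *
    exact abs_le.2 ⟨by omega, by omega⟩
  · rw [digitSum_sub h0 h1 hc.abs_digit_le hd.abs_digit_le, h, sub_self]

lemma IsDigitSeq.digitSum_nonneg (h0 : 0 < β) {c : ℕ → ℤ} (hc : IsDigitSeq N c) :
    0 ≤ digitSum β c :=
  tsum_nonneg fun k => mul_nonneg (by exact_mod_cast (hc k).1) (pow_nonneg h0.le k)

lemma finite_digitSums (h0 : 0 < β) (h1 : β < 1) (k : ℕ) :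
    {b | ∃ v, IsDigitSeq N v ∧ (∀ i, k ≤ i → v i = 0) ∧ b = digitSum β v}.Finite := by
  induction k with
  | zero =>
    refine (Set.finite_singleton (digitSum β fun _ => 0)).subset ?_
    rintro b ⟨v, -, hv, rfl⟩
    rw [Set.mem_singleton_iff, show v = fun _ => 0 from funext fun i => hv i i.zero_le]
  | succ k ih =>
    refine (Set.Finite.image2 (fun (i : ℤ) (b : ℝ) => (i : ℝ) + β * b)
      (Set.finite_Icc (0 : ℤ) N) ih).subset ?_
    rintro b ⟨v, hd, hv, rfl⟩
    exact ⟨v 0, hd 0, _, ⟨fun n => v (n + 1), fun n => hd _, fun i hi => hv _ (by omega), rfl⟩,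
      (digitSum_eq_zero_add h0 h1 hd.abs_digit_le).symm⟩

end DigitSum

section Gamma

variable {N : ℕ} {β : ℝ}

lemma isCompact_Gamma (h0 : 0 < β) (h1 : β < 1) : IsCompact (Gamma N β) := by
  have hK : IsCompact (Set.univ.pi fun _ : ℕ => Set.Icc 0 (N : ℤ)) :=
    isCompact_univ_pi fun _ => (Set.finite_Icc _ _).isCompact
  have hf : ContinuousOn (fun c : ℕ → ℤ => (1 - β) / N * digitSum β c)
      (Set.univ.pi fun _ : ℕ => Set.Icc 0 (N : ℤ)) := by
    refine ContinuousOn.mul continuousOn_const ?_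
    refine continuousOn_tsum (u := fun k => (N : ℝ) * β ^ k) (fun k => ?_)
      ((summable_geometric_of_lt_one h0.le h1).mul_left _) fun k c hc => ?_
    · have : Continuous fun c : ℕ → ℤ => (c k : ℝ) * β ^ k := by fun_prop
      exact this.continuousOn
    · have hc' : IsDigitSeq N c := fun k => hc k trivial
      rw [norm_mul, Real.norm_eq_abs, Real.norm_eq_abs, abs_of_pos (pow_pos h0 k)]
      gcongr
      exact_mod_cast hc'.abs_digit_le k
  convert hK.image_of_continuousOn hf using 1
  ext x
  rw [mem_Gamma_iff]
  constructor
  · rintro ⟨c, hc, rfl⟩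
    exact ⟨c, fun k _ => hc k, rfl⟩
  · rintro ⟨c, hc, rfl⟩
    exact ⟨c, fun k => hc k trivial, rfl⟩

lemma zero_mem_Gamma : (0 : ℝ) ∈ Gamma N β :=
  mem_Gamma_iff.2 ⟨fun _ => 0, fun _ => by simp, by simp [digitSum]⟩

lemma one_sub_mem_Gamma (hN : 0 < N) (h0 : 0 < β) (h1 : β < 1) {x : ℝ}
    (hx : x ∈ Gamma N β) : 1 - x ∈ Gamma N β := by
  obtain ⟨c, hc, rfl⟩ := mem_Gamma_iff.1 hx
  refine mem_Gamma_iff.2 ⟨fun n => N - c n, fun n => ?_, ?_⟩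
  · have := hc n
    simp only [Set.mem_Icc] at *
    omega
  · rw [digitSum_sub h0 h1 (M := N) (c := fun _ => (N : ℤ)) (by simp) hc.abs_digit_le,
      digitSum_const h0 h1]
    have : (N : ℝ) ≠ 0 := by positivity
    have : 1 - β ≠ 0 := by linarith
    push_cast
    field_simp

lemma one_mem_Gamma (hN : 0 < N) (h0 : 0 < β) (h1 : β < 1) : (1 : ℝ) ∈ Gamma N β := by
  simpa using one_sub_mem_Gamma hN h0 h1 zero_mem_Gamma

lemma nonneg_of_mem_Gamma (h0 : 0 < β) (h1 : β < 1) {x : ℝ} (hx : x ∈ Gamma N β) : 0 ≤ x := by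
  obtain ⟨c, hc, rfl⟩ := mem_Gamma_iff.1 hx
  exact mul_nonneg (div_nonneg (by linarith) (by positivity)) (hc.digitSum_nonneg h0)

lemma le_one_of_mem_Gamma (hN : 0 < N) (h0 : 0 < β) (h1 : β < 1) {x : ℝ}
    (hx : x ∈ Gamma N β) : x ≤ 1 := by
  have := nonneg_of_mem_Gamma h0 h1 (one_sub_mem_Gamma hN h0 h1 hx)
  linarith

lemma mem_Gamma_iff_exists_piece (h0 : 0 < β) (h1 : β < 1) {x : ℝ} :
    x ∈ Gamma N β ↔ ∃ i : ℕ, i ≤ N ∧ ∃ y ∈ Gamma N β, x = β * y + i * ((1 - β) / N) := by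
  constructor
  · intro hx
    obtain ⟨c, hc, rfl⟩ := mem_Gamma_iff.1 hx
    have hc0 := hc 0
    simp only [Set.mem_Icc] at hc0
    refine ⟨(c 0).toNat, by omega, _, mem_Gamma_iff.2 ⟨fun n => c (n + 1), fun n => hc _, rfl⟩, ?_⟩
    have : (((c 0).toNat : ℕ) : ℝ) = (c 0 : ℝ) := by
      exact_mod_cast congrArg (Int.cast (R := ℝ)) (Int.toNat_of_nonneg hc0.1)
    rw [digitSum_eq_zero_add h0 h1 hc.abs_digit_le, this]
    ring
  · rintro ⟨i, hi, y, hy, rfl⟩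
    obtain ⟨c, hc, rfl⟩ := mem_Gamma_iff.1 hy
    have hi' : (i : ℤ) ∈ Set.Icc 0 (N : ℤ) := by simpa using hi
    refine mem_Gamma_iff.2 ⟨_, hc.prepend hi', ?_⟩
    rw [digitSum_prepend h0 h1 hi' hc, Int.cast_natCast]
    ring

/-- `Γ` cannot be split into two parts at distance more than `(1-β)/N - β`, the length of its
largest gaps. -/
lemma forall_mem_Gamma_of_chain (hN : 0 < N) (h0 : 0 < β) (h1 : β < 1)
    (hβ : 2 * β < (1 - β) / N) {S : ℝ → Prop}
    (hS : ∀ x ∈ Gamma N β, ∀ y ∈ Gamma N β, |x - y| ≤ (1 - β) / N - β → S x → S y)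
    {z : ℝ} (hz : z ∈ Gamma N β) (hSz : S z) : ∀ x ∈ Gamma N β, S x := by
  have hmem : ∀ i ≤ N, ∀ y ∈ Gamma N β, β * y + i * ((1 - β) / N) ∈ Gamma N β :=
    fun i hi y hy => (mem_Gamma_iff_exists_piece h0 h1).2 ⟨i, hi, y, hy, rfl⟩
  have hpiece : ∀ i ≤ N, ∀ x ∈ Gamma N β, ∀ y ∈ Gamma N β,
      S (β * x + i * ((1 - β) / N)) → S (β * y + i * ((1 - β) / N)) := by
    intro i hi x hx y hy
    refine hS _ (hmem i hi x hx) _ (hmem i hi y hy) ?_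
    have hx0 := nonneg_of_mem_Gamma h0 h1 hx
    have hx1 := le_one_of_mem_Gamma hN h0 h1 hx
    have hy0 := nonneg_of_mem_Gamma h0 h1 hy
    have hy1 := le_one_of_mem_Gamma hN h0 h1 hy
    rw [abs_le]
    constructor <;> nlinarith
  have hone := one_mem_Gamma hN h0 h1
  have hzero : (0 : ℝ) ∈ Gamma N β := zero_mem_Gamma
  have hstep : ∀ i, i + 1 ≤ N →
      (S (β * 0 + i * ((1 - β) / N)) ↔ S (β * 0 + (i + 1 : ℕ) * ((1 - β) / N))) := by
    intro i hi
    have hd : β * 0 + (i + 1 : ℕ) * ((1 - β) / N) - (β * 1 + i * ((1 - β) / N))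
        = (1 - β) / N - β := by push_cast; ring
    have hnn : 0 ≤ (1 - β) / N - β := by linarith
    constructor
    · intro h
      refine hS _ (hmem i (by omega) 1 hone) _ (hmem (i + 1) hi 0 hzero) ?_
        (hpiece i (by omega) 0 hzero 1 hone h)
      rw [abs_sub_comm, hd, abs_of_nonneg hnn]
    · intro h
      refine hpiece i (by omega) 1 hone 0 hzero ?_
      refine hS _ (hmem (i + 1) hi 0 hzero) _ (hmem i (by omega) 1 hone) ?_ h
      rw [hd, abs_of_nonneg hnn]
  have hall : ∀ i ≤ N, (S (β * 0 + (0 : ℕ) * ((1 - β) / N)) ↔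
      S (β * 0 + i * ((1 - β) / N))) := by
    intro i
    induction i with
    | zero => simp
    | succ i ih => exact fun hi => (ih (by omega)).trans (hstep i hi)
  obtain ⟨i, hi, y, hy, rfl⟩ := (mem_Gamma_iff_exists_piece h0 h1).1 hz
  intro x hx
  obtain ⟨l, hl, u, hu, rfl⟩ := (mem_Gamma_iff_exists_piece h0 h1).1 hx
  exact hpiece l hl 0 hzero u hu
    ((hall l hl).1 ((hall i hi).2 (hpiece i hi y hy 0 hzero hSz)))

/-- An orientation preserving similitude mapping `Γ` into itself is a composition of the
generating maps. -/
lemma exists_word_of_mapsTo_Gamma (hN : 0 < N) (h0 : 0 < β) (h1 : β < 1)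
    (hβ : 2 * β < (1 - β) / N) {r b : ℝ} (hr : 0 < r)
    (h : ∀ x ∈ Gamma N β, r * x + b ∈ Gamma N β) :
    ∃ k v, IsDigitSeq N v ∧ (∀ i, k ≤ i → v i = 0) ∧ r = β ^ k ∧
      b = (1 - β) / N * digitSum β v := by
  obtain ⟨n, hn⟩ := exists_pow_lt_of_lt_one hr h1
  induction n generalizing r b with
  | zero =>
    have hb := nonneg_of_mem_Gamma h0 h1 (h 0 zero_mem_Gamma)
    have hb1 := le_one_of_mem_Gamma hN h0 h1 (h 1 (one_mem_Gamma hN h0 h1))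
    simp only [pow_zero] at hn
    linarith
  | succ n ih =>
    have hb := nonneg_of_mem_Gamma h0 h1 (h 0 zero_mem_Gamma)
    have hb1 := le_one_of_mem_Gamma hN h0 h1 (h 1 (one_mem_Gamma hN h0 h1))
    rcases lt_or_ge r 1 with hr1 | hr1
    · obtain ⟨i, hi, y, hy, hxy⟩ := (mem_Gamma_iff_exists_piece h0 h1).1 (h 0 zero_mem_Gamma)
      have key := forall_mem_Gamma_of_chain hN h0 h1 hβ
        (S := fun x => ∃ y ∈ Gamma N β, r * x + b = β * y + i * ((1 - β) / N)) ?_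
        zero_mem_Gamma ⟨y, hy, hxy⟩
      · have hmap : ∀ x ∈ Gamma N β,
            r / β * x + (b - i * ((1 - β) / N)) / β ∈ Gamma N β := by
          intro x hx
          obtain ⟨y, hy, hxy⟩ := key x hx
          have : r / β * x + (b - i * ((1 - β) / N)) / β = y := by
            rw [div_mul_eq_mul_div, ← add_div, div_eq_iff h0.ne']
            linarith
          rwa [this]
        obtain ⟨k, v, hv, hvk, hk, hbv⟩ := ih (div_pos hr h0) hmap
          (by rw [lt_div_iff₀ h0, ← pow_succ]; exact hn)
        have hi' : (i : ℤ) ∈ Set.Icc 0 (N : ℤ) := by simpa using hi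
        refine ⟨k + 1, _, hv.prepend hi', ?_, ?_, ?_⟩
        · rintro (_ | l) hl
          · omega
          · exact hvk l (by omega)
        · rw [pow_succ, ← hk]
          field_simp
        · rw [digitSum_prepend h0 h1 hi' hv, Int.cast_natCast]
          rw [div_eq_iff h0.ne'] at hbv
          linarith
      · rintro x hx x' hx' hd ⟨y, hy, hxy⟩
        obtain ⟨l, hl, u, hu, hxu⟩ := (mem_Gamma_iff_exists_piece h0 h1).1 (h x' hx')
        obtain rfl | hne := eq_or_ne i l
        · exact ⟨u, hu, hxu⟩
        exfalso
        have ha : 0 < (1 - β) / N := by linarith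
        have hlt : |r * x + b - (r * x' + b)| < (1 - β) / N - β := by
          rw [show r * x + b - (r * x' + b) = r * (x - x') by ring, abs_mul, abs_of_pos hr]
          nlinarith [abs_nonneg (x - x')]
        rw [hxy, hxu, abs_lt] at hlt
        have hy0 := nonneg_of_mem_Gamma h0 h1 hy
        have hy1 := le_one_of_mem_Gamma hN h0 h1 hy
        have hu0 := nonneg_of_mem_Gamma h0 h1 hu
        have hu1 := le_one_of_mem_Gamma hN h0 h1 hu
        have hβy := mul_le_of_le_one_right h0.le hy1
        have hβu := mul_le_of_le_one_right h0.le hu1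
        have hβy' := mul_nonneg h0.le hy0
        have hβu' := mul_nonneg h0.le hu0
        rcases lt_or_gt_of_ne hne with hil | hil
        · have : (i : ℝ) + 1 ≤ l := by exact_mod_cast hil
          nlinarith [mul_le_mul_of_nonneg_right this ha.le]
        · have : (l : ℝ) + 1 ≤ i := by exact_mod_cast hil
          nlinarith [mul_le_mul_of_nonneg_right this ha.le]
    · refine ⟨0, fun _ => 0, fun _ => by simp, by simp, ?_, ?_⟩
      · rw [pow_zero]
        linarith
      · simp only [digitSum, Int.cast_zero, zero_mul, tsum_zero, mul_zero]
        linarith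

end Gamma

section Translate

variable {N : ℕ} {β t : ℝ}

lemma mem_union_translate_iff {A : Set ℝ} {y : ℝ} :
    y ∈ A ∪ (fun x => x + t) '' A ↔ y ∈ A ∨ y - t ∈ A := by
  rw [Set.mem_union, Set.image_add_right, Set.mem_preimage, sub_eq_add_neg]

lemma IsDigitSeq.add_shift {k : ℕ} {v c : ℕ → ℤ} (hv : IsDigitSeq N v)
    (hvk : ∀ i, k ≤ i → v i = 0) (hc : IsDigitSeq N c) :
    IsDigitSeq N fun n => v n + HSCantor.shift k c n := by
  intro n
  rcases lt_or_ge n k with h | h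
  · simpa [HSCantor.shift, h.not_ge] using hv n
  · simpa [hvk n h] using hc.shift k n

lemma IsDigitSeq.digitSum_add_shift (h0 : 0 < β) (h1 : β < 1) {k : ℕ} {v c : ℕ → ℤ}
    (hv : IsDigitSeq N v) (hc : IsDigitSeq N c) :
    digitSum β (fun n => v n + HSCantor.shift k c n) = digitSum β v + β ^ k * digitSum β c := by
  rw [digitSum_add h0 h1 hv.abs_digit_le (abs_shift_le hc.abs_digit_le k),
    digitSum_shift h0 h1 hc.abs_digit_le]

/-- By the symmetry of `Γ ∪ (Γ + t)`, if this set is self-similar then it is covered by its images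
under orientation preserving similitudes that map it into itself. -/
lemma IsSelfSimilar.exists_pos_similitude (hN : 0 < N) (h0 : 0 < β) (h1 : β < 1)
    (h : IsSelfSimilar (Gamma N β ∪ (fun x => x + t) '' Gamma N β)) {x : ℝ}
    (hx : x ∈ Gamma N β ∪ (fun x => x + t) '' Gamma N β) :
    ∃ r b : ℝ, 0 < r ∧ r < 1 ∧
      (∀ y ∈ Gamma N β ∪ (fun x => x + t) '' Gamma N β,
        r * y + b ∈ Gamma N β ∪ (fun x => x + t) '' Gamma N β) ∧
      ∃ y ∈ Gamma N β ∪ (fun x => x + t) '' Gamma N β, x = r * y + b := by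
  obtain ⟨-, -, F, hF, hE⟩ := h
  set E := Gamma N β ∪ (fun x => x + t) '' Gamma N β with hEdef
  have hsymm : ∀ y ∈ E, 1 + t - y ∈ E := by
    intro y hy
    rw [hEdef, mem_union_translate_iff] at hy ⊢
    rcases hy with hy | hy
    · right
      convert one_sub_mem_Gamma hN h0 h1 hy using 1
      ring
    · left
      convert one_sub_mem_Gamma hN h0 h1 hy using 1
      ring
  have hmaps : ∀ p ∈ F, ∀ y ∈ E, p.1 * y + p.2 ∈ E := by
    intro p hp y hy
    rw [hE]
    exact Set.mem_biUnion hp ⟨y, hy, rfl⟩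
  rw [hE] at hx
  obtain ⟨p, hp, y, hy, hxy⟩ := Set.mem_iUnion₂.1 hx
  obtain ⟨hp0, hp1⟩ := hF p hp
  rcases lt_or_gt_of_ne (abs_pos.1 hp0) with hneg | hpos
  · rw [abs_of_neg hneg] at hp1
    refine ⟨-p.1, p.2 + p.1 * (1 + t), by linarith, hp1, fun z hz => ?_,
      1 + t - y, hsymm y hy, ?_⟩
    · convert hmaps p hp _ (hsymm z hz) using 1
      ring
    · rw [← hxy]
      ring
  · rw [abs_of_pos hpos] at hp1
    exact ⟨p.1, p.2, hpos, hp1, hmaps p hp, y, hy, hxy.symm⟩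

/-- If `Γ ∪ (Γ + t)` is self-similar, then `t` has a finite expansion in powers of `β⁻¹`. -/
lemma IsSelfSimilar.exists_digits (hN : 0 < N) (h0 : 0 < β) (h1 : β < 1)
    (hβ : 2 * β < (1 - β) / N) (ht : 0 < t)
    (h : IsSelfSimilar (Gamma N β ∪ (fun x => x + t) '' Gamma N β)) :
    ∃ m w, IsDigitSeq N w ∧ (∀ i, m ≤ i → w i = 0) ∧
      β ^ m * t = (1 - β) / N * digitSum β w := by
  have hz : (0 : ℝ) ∈ Gamma N β ∪ (fun x => x + t) '' Gamma N β := Or.inl zero_mem_Gamma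
  have hbound : ∀ y ∈ Gamma N β ∪ (fun x => x + t) '' Gamma N β, 0 ≤ y ∧ y ≤ 1 + t := by
    intro y hy
    rcases mem_union_translate_iff.1 hy with hy | hy <;>
    · have := nonneg_of_mem_Gamma h0 h1 hy
      have := le_one_of_mem_Gamma hN h0 h1 hy
      constructor <;> linarith
  obtain ⟨r, b, hr0, hr1, hmaps, y, hy, hxy⟩ := h.exists_pos_similitude hN h0 h1 hz
  have hb : b = 0 := by
    have hb0 := (hbound _ (hmaps 0 hz)).1
    have := mul_nonneg hr0.le (hbound y hy).1
    linarith
  subst hb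
  have hpow : ∀ n, ∀ y ∈ Gamma N β ∪ (fun x => x + t) '' Gamma N β,
      r ^ n * y ∈ Gamma N β ∪ (fun x => x + t) '' Gamma N β := by
    intro n
    induction n with
    | zero => simp
    | succ n ih =>
      intro y hy
      have := hmaps _ (ih y hy)
      rwa [add_zero, ← mul_assoc, ← pow_succ'] at this
  obtain ⟨n, hn⟩ := exists_pow_lt_of_lt_one (show 0 < t / (1 + t) by positivity) hr1
  rw [lt_div_iff₀ (by linarith)] at hn
  have hmapsΓ : ∀ x ∈ Gamma N β, r ^ n * x + r ^ n * t ∈ Gamma N β := by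
    intro x hx
    rw [← mul_add]
    have hxt : x + t ∈ Gamma N β ∪ (fun x => x + t) '' Gamma N β := Or.inr ⟨x, hx, rfl⟩
    refine (mem_union_translate_iff.1 (hpow n _ hxt)).resolve_right fun hcon => ?_
    have := nonneg_of_mem_Gamma h0 h1 hcon
    nlinarith [(hbound _ hxt).2, pow_pos hr0 n]
  obtain ⟨m, w, hw, hwm, hm, hwt⟩ :=
    exists_word_of_mapsTo_Gamma hN h0 h1 hβ (pow_pos hr0 n) hmapsΓ
  exact ⟨m, w, hw, hwm, by rw [← hm, hwt]⟩

lemma one_add_gap_le_translation (h0 : 0 < β) (h1 : β < 1)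
    (hβ : 2 * β < (1 - β) / N) {m : ℕ} {w : ℕ → ℤ} (hw : IsDigitSeq N w)
    (hwm : ∀ i, m ≤ i → w i = 0) (hwt : β ^ m * t = (1 - β) / N * digitSum β w)
    {p : ℕ} (hp : 0 < w p) : 1 + ((1 - β) / N - β) ≤ t := by
  have hpm : p < m := by
    by_contra hcon
    rw [hwm p (by omega)] at hp
    exact hp.false
  have hle : (w p : ℝ) * β ^ p ≤ digitSum β w :=
    (summable_digits h0 h1 hw.abs_digit_le).le_tsum p fun k _ =>
      mul_nonneg (by exact_mod_cast (hw k).1) (pow_nonneg h0.le k)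
  have hwp : (1 : ℝ) ≤ w p := by exact_mod_cast hp
  have hpow : β ^ m ≤ β * β ^ p := by
    rw [← pow_succ']
    exact pow_le_pow_of_le_one h0.le h1.le hpm
  have hβp := pow_pos h0 p
  have ha : 0 < (1 - β) / N := by linarith
  have hpos : 0 < t := by
    have : 0 < β ^ m * t := by
      rw [hwt]
      exact mul_pos ha (lt_of_lt_of_le (by positivity) hle)
    exact pos_of_mul_pos_right this (by positivity)
  have hat : (1 - β) / N ≤ β * t := by
    refine le_of_mul_le_mul_right ?_ hβp
    calc (1 - β) / N * β ^ p ≤ (1 - β) / N * digitSum β w := by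
          gcongr
          nlinarith
      _ = β ^ m * t := hwt.symm
      _ ≤ β * β ^ p * t := by gcongr
      _ = β * t * β ^ p := by ring
  refine le_of_mul_le_mul_left ?_ h0
  nlinarith

/-- An orientation preserving contraction mapping `Γ ∪ (Γ + t)` into itself and meeting `Γ` maps
`Γ ∪ (Γ + t)` into `Γ`. -/
lemma mapsTo_Gamma_of_mapsTo_union (hN : 0 < N) (h0 : 0 < β) (h1 : β < 1)
    (hβ : 2 * β < (1 - β) / N) (ht : 1 + ((1 - β) / N - β) ≤ t) {r b : ℝ} (hr0 : 0 < r)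
    (hr1 : r < 1)
    (hmaps : ∀ y ∈ Gamma N β ∪ (fun x => x + t) '' Gamma N β,
        r * y + b ∈ Gamma N β ∪ (fun x => x + t) '' Gamma N β)
    {y : ℝ} (hy : y ∈ Gamma N β ∪ (fun x => x + t) '' Gamma N β)
    (hyΓ : r * y + b ∈ Gamma N β) :
    (∀ x ∈ Gamma N β, r * x + b ∈ Gamma N β) ∧
      ∀ x ∈ Gamma N β, r * x + (r * t + b) ∈ Gamma N β := by
  have hE : ∀ {z : ℝ}, z ∈ Gamma N β ∪ (fun x => x + t) '' Gamma N β →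
      z < t → z ∈ Gamma N β := by
    intro z hz hzt
    refine (mem_union_translate_iff.1 hz).resolve_right fun hcon => ?_
    have := nonneg_of_mem_Gamma h0 h1 hcon
    linarith
  have hchain : ∀ d : ℝ, (∀ x ∈ Gamma N β, r * x + d ∈
      Gamma N β ∪ (fun x => x + t) '' Gamma N β) → ∀ z ∈ Gamma N β, r * z + d ∈ Gamma N β →
      ∀ x ∈ Gamma N β, r * x + d ∈ Gamma N β := by
    intro d hd z hz hzd
    refine forall_mem_Gamma_of_chain hN h0 h1 hβ (fun x hx x' hx' hxx hS => ?_) hz hzd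
    refine hE (hd x' hx') ?_
    have hle := le_one_of_mem_Gamma hN h0 h1 hS
    have := (abs_le.1 hxx).1
    nlinarith
  have hd0 : ∀ x ∈ Gamma N β, r * x + b ∈ Gamma N β ∪ (fun x => x + t) '' Gamma N β :=
    fun x hx => hmaps x (Or.inl hx)
  have hdt : ∀ x ∈ Gamma N β, r * x + (r * t + b) ∈
      Gamma N β ∪ (fun x => x + t) '' Gamma N β := by
    intro x hx
    convert hmaps (x + t) (Or.inr ⟨x, hx, rfl⟩) using 1
    ring
  have hy1 := le_one_of_mem_Gamma hN h0 h1 hyΓ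
  have hfirst : ∀ x ∈ Gamma N β, r * x + b ∈ Gamma N β := by
    refine hchain b hd0 0 zero_mem_Gamma (hE (hd0 0 zero_mem_Gamma) ?_)
    have hy0 : 0 ≤ y := by
      rcases mem_union_translate_iff.1 hy with hy | hy <;>
      · have := nonneg_of_mem_Gamma h0 h1 hy
        linarith
    nlinarith
  refine ⟨hfirst, hchain _ hdt 0 zero_mem_Gamma (hE (hdt 0 zero_mem_Gamma) ?_)⟩
  have := le_one_of_mem_Gamma hN h0 h1 (hfirst 1 (one_mem_Gamma hN h0 h1))
  nlinarith

/-- If `Γ ∪ (Γ + t)` is self-similar and `w` is the digit sequence of `β^m t`, then at a suitable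
position of any digit sequence `c` one can add `w` to `c`, or subtract `w` from `c`, digit by
digit. -/
lemma IsSelfSimilar.exists_add_or_sub (hN : 0 < N) (h0 : 0 < β) (h1 : β < 1)
    (hβ : 2 * β < (1 - β) / N)
    (h : IsSelfSimilar (Gamma N β ∪ (fun x => x + t) '' Gamma N β))
    (ht : 1 + ((1 - β) / N - β) ≤ t) {m : ℕ} {w : ℕ → ℤ} (hw : IsDigitSeq N w)
    (hwm : ∀ i, m ≤ i → w i = 0) (hwt : β ^ m * t = (1 - β) / N * digitSum β w)
    {c : ℕ → ℤ} (hc : IsDigitSeq N c) :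
    ∃ k : ℕ, (∀ p, 0 < w p → m ≤ k + p ∧ c (k + p - m) + w p ≤ N) ∨
      ∀ p, 0 < w p → m ≤ k + p ∧ w p ≤ c (k + p - m) := by
  have hN' : (0 : ℝ) < N := by exact_mod_cast hN
  have ha : 0 < (1 - β) / N := by linarith
  have hβN : β * (2 * N) < 1 - β := by
    rw [lt_div_iff₀ hN'] at hβ
    linarith
  have hxΓ : (1 - β) / N * digitSum β c ∈ Gamma N β := mem_Gamma_iff.2 ⟨c, hc, rfl⟩
  obtain ⟨r, b, hr0, hr1, hmaps, y, hy, hxy⟩ :=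
    h.exists_pos_similitude hN h0 h1 (Or.inl hxΓ)
  obtain ⟨hf0, hft⟩ :=
    mapsTo_Gamma_of_mapsTo_union hN h0 h1 hβ ht hr0 hr1 hmaps hy (hxy ▸ hxΓ)
  obtain ⟨k, v, hv, hvk, rfl, rfl⟩ := exists_word_of_mapsTo_Gamma hN h0 h1 hβ hr0 hf0
  obtain ⟨k', v', hv', hvk', hkk', hv't⟩ := exists_word_of_mapsTo_Gamma hN h0 h1 hβ hr0 hft
  obtain rfl := pow_right_injective₀ h0 h1.ne hkk'
  have hdiff : ∀ p, 0 < w p →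
      m ≤ k + p ∧ k + p - m < k ∧ v' (k + p - m) = v (k + p - m) + w p := by
    intro p hp
    have hpm : p < m := by
      by_contra hcon
      rw [hwm p (by omega)] at hp
      exact hp.false
    have hvv : ∀ n, |v' n - v n| ≤ (N : ℤ) := by
      intro n
      have := hv n
      have := hv' n
      simp only [Set.mem_Icc] at *
      exact abs_le.2 ⟨by omega, by omega⟩
    have he := eq_zero_of_digitSum_eq_zero h0 h1 (M := 2 * N) (by push_cast; exact hβN)
      (e := fun n => shift m (fun n => v' n - v n) n - shift k w n) (fun n => ?_) ?_ (k + p)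
    · simp only [shift, Nat.le_add_right, if_true, Nat.add_sub_cancel_left] at he
      split_ifs at he with hmk
      · exact ⟨hmk, by omega, by omega⟩
      · omega
    · refine (abs_sub _ _).trans ?_
      have := abs_shift_le hvv m n
      have := abs_shift_le hw.abs_digit_le k n
      omega
    · rw [digitSum_sub h0 h1 (abs_shift_le hvv m) (abs_shift_le hw.abs_digit_le k),
        digitSum_shift h0 h1 hvv, digitSum_shift h0 h1 hw.abs_digit_le,
        digitSum_sub h0 h1 hv'.abs_digit_le hv.abs_digit_le]
      refine (mul_eq_zero.1 (?_ : (1 - β) / N * _ = 0)).resolve_left ha.ne'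
      linear_combination (-β ^ m) * hv't + β ^ k * hwt
  have hprefix : ∀ u, IsDigitSeq N u → (∀ i, k ≤ i → u i = 0) → ∀ z ∈ Gamma N β,
      (1 - β) / N * digitSum β c = β ^ k * z + (1 - β) / N * digitSum β u →
      ∀ i < k, c i = u i := by
    intro u hu huk z hz hcz i hi
    obtain ⟨d, hd, rfl⟩ := mem_Gamma_iff.1 hz
    have : c = fun n => u n + shift k d n := by
      refine hc.ext_of_digitSum_eq h0 h1 (by nlinarith) (hu.add_shift huk hd) ?_
      rw [hu.digitSum_add_shift h0 h1 hd]
      refine mul_left_cancel₀ ha.ne' ?_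
      linarith
    rw [this]
    simp [shift, hi.not_ge]
  refine ⟨k, ?_⟩
  rcases mem_union_translate_iff.1 hy with hy | hy
  · left
    intro p hp
    obtain ⟨hm, hk, hvw⟩ := hdiff p hp
    refine ⟨hm, ?_⟩
    rw [hprefix v hv hvk y hy hxy _ hk, ← hvw]
    exact (hv' _).2
  · right
    intro p hp
    obtain ⟨hm, hk, hvw⟩ := hdiff p hp
    refine ⟨hm, ?_⟩
    rw [hprefix v' hv' hvk' (y - t) hy (by rw [hxy, ← hv't]; ring) _ hk, hvw]
    linarith [(hv (k + p - m)).1]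

/-- A digit sequence that can be added to or subtracted from any other digit sequence at a suitable
position has at most one nonzero digit. -/
lemma eq_of_pos_of_exists_add_or_sub {m : ℕ} {w : ℕ → ℤ}
    (hcov : ∀ c, IsDigitSeq N c →
      ∃ k : ℕ, (∀ p, 0 < w p → m ≤ k + p ∧ c (k + p - m) + w p ≤ N) ∨
        ∀ p, 0 < w p → m ≤ k + p ∧ w p ≤ c (k + p - m))
    {p q : ℕ} (hp : 0 < w p) (hq : 0 < w q) : p = q := by
  wlog hpq : p < q generalizing p q
  · rcases lt_or_eq_of_le (not_lt.1 hpq) with hlt | heq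
    · exact (this hq hp hlt).symm
    · exact heq.symm
  exfalso
  obtain ⟨k, hk⟩ := hcov (fun n => if n / (q - p) % 2 = 0 then 0 else N) fun n => by
    dsimp only
    split_ifs <;> simp
  have hidx : m ≤ k + p → (k + q - m) / (q - p) = (k + p - m) / (q - p) + 1 := by
    intro hm
    rw [← Nat.add_div_right _ (by omega : 0 < q - p)]
    congr 1
    omega
  rcases hk with hk | hk <;>
  · obtain ⟨hm, h₁⟩ := hk p hp
    obtain ⟨-, h₂⟩ := hk q hq
    rw [hidx hm] at h₂
    split_ifs at h₁ h₂ <;> omega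

/-- If `β^k t = j(1-β)/N` with `k ≥ 1` and `2j ≤ N + 1`, then `Γ ∪ (Γ + t)` is self-similar. -/
lemma isSelfSimilar_of_single_digit (h0 : 0 < β) (h1 : β < 1) {j k : ℕ}
    (hj : 2 * j ≤ N + 1) (hk : 1 ≤ k) (ht : β ^ k * t = (1 - β) / N * j) :
    IsSelfSimilar (Gamma N β ∪ (fun x => x + t) '' Gamma N β) := by
  have hcomp : IsCompact (Gamma N β) := isCompact_Gamma h0 h1
  refine ⟨⟨0, Or.inl zero_mem_Gamma⟩, hcomp.union (hcomp.image (by fun_prop)), ?_⟩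
  have hfin : {q : ℝ × ℝ | q.1 = β ^ k ∧ ∃ v, IsDigitSeq N v ∧ (∀ i, k ≤ i → v i = 0) ∧
      v 0 + j ≤ N ∧ (q.2 = (1 - β) / N * digitSum β v ∨
        q.2 = (1 - β) / N * digitSum β v + t)}.Finite := by
    have hB := finite_digitSums (N := N) h0 h1 k
    refine ((Set.finite_singleton (β ^ k)).prod ((hB.image fun b => (1 - β) / N * b).union
      (hB.image fun b => (1 - β) / N * b + t))).subset ?_
    rintro ⟨q₁, q₂⟩ ⟨rfl, v, hv, hvk, -, rfl | rfl⟩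
    · exact ⟨rfl, Or.inl ⟨_, ⟨v, hv, hvk, rfl⟩, rfl⟩⟩
    · exact ⟨rfl, Or.inr ⟨_, ⟨v, hv, hvk, rfl⟩, rfl⟩⟩
  have hsum : ∀ v d : ℕ → ℤ, IsDigitSeq N v → IsDigitSeq N d →
      digitSum β (fun n => v n + shift k d n + (Pi.single 0 (j : ℤ) : ℕ → ℤ) n) =
        digitSum β v + β ^ k * digitSum β d + j := by
    intro v d hv hd
    rw [digitSum_add (M := 2 * N) (M' := j) h0 h1 _ _, hv.digitSum_add_shift h0 h1 hd,
      digitSum_single]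
    · simp
    · intro n
      have := abs_add_le (v n) (shift k d n)
      have := hv.abs_digit_le n
      have := abs_shift_le hd.abs_digit_le k n
      omega
    · intro n
      rcases eq_or_ne n 0 with rfl | hn
      · simp
      · simp [hn]
  have hmaps : ∀ v, IsDigitSeq N v → (∀ i, k ≤ i → v i = 0) → v 0 + j ≤ N →
      ∀ y ∈ Gamma N β ∪ (fun x => x + t) '' Gamma N β,
        β ^ k * y + (1 - β) / N * digitSum β v ∈ Gamma N β := by
    intro v hv hvk hv0 y hy
    rcases mem_union_translate_iff.1 hy with hy | hy
    · obtain ⟨d, hd, rfl⟩ := mem_Gamma_iff.1 hy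
      refine mem_Gamma_iff.2 ⟨_, hv.add_shift hvk hd, ?_⟩
      rw [hv.digitSum_add_shift h0 h1 hd]
      ring
    · obtain ⟨d, hd, hyd⟩ := mem_Gamma_iff.1 hy
      refine mem_Gamma_iff.2
        ⟨fun n => v n + shift k d n + (Pi.single 0 (j : ℤ) : ℕ → ℤ) n, fun n => ?_, ?_⟩
      · rcases eq_or_ne n 0 with rfl | hn
        · have := (hv 0).1
          have : ¬ k ≤ 0 := by omega
          simp only [shift, this, if_false, Pi.single_eq_same, Set.mem_Icc]
          omega
        · simpa [hn] using hv.add_shift hvk hd n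
      · rw [hsum v d hv hd]
        linear_combination β ^ k * hyd + ht
  have hcover : ∀ x ∈ Gamma N β, ∃ v, IsDigitSeq N v ∧ (∀ i, k ≤ i → v i = 0) ∧ v 0 + j ≤ N ∧
      ∃ y ∈ Gamma N β ∪ (fun x => x + t) '' Gamma N β,
        β ^ k * y + (1 - β) / N * digitSum β v = x := by
    intro x hx
    obtain ⟨c, hc, rfl⟩ := mem_Gamma_iff.1 hx
    have hd : IsDigitSeq N fun n => c (n + k) := fun n => hc _
    have hc0 := hc 0
    rw [Set.mem_Icc] at hc0
    have hzΓ : (1 - β) / N * digitSum β (fun n => c (n + k)) ∈ Gamma N β :=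
      mem_Gamma_iff.2 ⟨_, hd, rfl⟩
    by_cases hcj : c 0 + j ≤ N
    · have hv : IsDigitSeq N fun n => if n < k then c n else 0 := by
        intro n
        dsimp only
        split_ifs
        · exact hc n
        · simp
      refine ⟨_, hv, fun i hi => if_neg (by omega), by simpa [show 0 < k by omega] using hcj,
        _, Or.inl hzΓ, ?_⟩
      have hcv : c = fun n => (if n < k then c n else 0) + shift k (fun n => c (n + k)) n := by
        funext n
        rcases lt_or_ge n k with h | h
        · simp [shift, h, h.not_ge]
        · simp [shift, h, h.not_gt]
      conv_rhs => rw [hcv, hv.digitSum_add_shift h0 h1 hd]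
      ring
    · have hv : IsDigitSeq N fun n => if n = 0 then c 0 - j else if n < k then c n else 0 := by
        intro n
        dsimp only
        split_ifs
        · rw [Set.mem_Icc]
          omega
        · exact hc n
        · simp
      refine ⟨_, hv, fun i hi => ?_, by simpa using hc0.2, _, Or.inr ⟨_, hzΓ, rfl⟩, ?_⟩
      · rw [if_neg (by omega), if_neg (by omega)]
      have hcv : c = fun n => (if n = 0 then c 0 - j else if n < k then c n else 0) +
          shift k (fun n => c (n + k)) n + (Pi.single 0 (j : ℤ) : ℕ → ℤ) n := by
        funext n
        rcases eq_or_ne n 0 with rfl | hn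
        · simp [shift, show ¬ k = 0 by omega]
        rcases lt_or_ge n k with h | h
        · simp [shift, hn, h, h.not_ge]
        · simp [shift, hn, h, h.not_gt]
      conv_rhs => rw [hcv, hsum _ _ hv hd]
      linear_combination ht
  refine ⟨hfin.toFinset, fun q hq => ?_, ?_⟩
  · obtain ⟨hq, -⟩ := hfin.mem_toFinset.1 hq
    rw [hq, abs_of_pos (pow_pos h0 k)]
    exact ⟨pow_pos h0 k, pow_lt_one₀ h0.le h1 (by omega)⟩
  · refine Set.Subset.antisymm (fun x hx => ?_) (Set.iUnion₂_subset fun q hq => ?_)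
    · rcases mem_union_translate_iff.1 hx with hx | hx
      · obtain ⟨v, hv, hvk, hv0, y, hy, hyx⟩ := hcover x hx
        exact Set.mem_biUnion (x := (β ^ k, (1 - β) / N * digitSum β v))
          (hfin.mem_toFinset.2 ⟨rfl, v, hv, hvk, hv0, Or.inl rfl⟩) ⟨y, hy, hyx⟩
      · obtain ⟨v, hv, hvk, hv0, y, hy, hyx⟩ := hcover _ hx
        refine Set.mem_biUnion (x := (β ^ k, (1 - β) / N * digitSum β v + t))
          (hfin.mem_toFinset.2 ⟨rfl, v, hv, hvk, hv0, Or.inr rfl⟩) ⟨y, hy, ?_⟩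
        dsimp only
        linarith
    · obtain ⟨hq₁, v, hv, hvk, hv0, hq₂⟩ := hfin.mem_toFinset.1 hq
      rintro _ ⟨y, hy, rfl⟩
      dsimp only
      rw [hq₁]
      rcases hq₂ with hq₂ | hq₂
      · rw [hq₂]
        exact Or.inl (hmaps v hv hvk hv0 y hy)
      · rw [hq₂]
        exact Or.inr ⟨_, hmaps v hv hvk hv0 y hy, by ring⟩

end Translate

/-- Suppose `0 < β < 1/(2N+1)` and `t > 0`. Then `Γ ∪ (Γ + t)` is a self-similar set iff
`t = j(1-β)/N · β^{-k}` for some `j ∈ {1,…,⌊(N+1)/2⌋}` and some integer `k ≥ 1`. -/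
theorem stmt4 (N : ℕ) (hN : 0 < N) (β : ℝ) (hβ0 : 0 < β) (hβ1 : β < 1 / (2 * N + 1))
    (t : ℝ) (ht : 0 < t) :
    IsSelfSimilar (Gamma N β ∪ (fun x => x + t) '' Gamma N β) ↔
      ∃ j k : ℕ, 1 ≤ j ∧ j ≤ (N + 1) / 2 ∧ 1 ≤ k ∧
        t = j * (1 - β) / N * β ^ (-(k : ℤ)) := by
  have hN' : (0 : ℝ) < N := by exact_mod_cast hN
  rw [lt_div_iff₀ (by positivity)] at hβ1
  have h1 : β < 1 := by nlinarith
  have hβ : 2 * β < (1 - β) / N := by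
    rw [lt_div_iff₀ hN']
    linarith
  constructor
  · intro h
    obtain ⟨m, w, hw, hwm, hwt⟩ := h.exists_digits hN hβ0 h1 hβ ht
    obtain ⟨p, hp⟩ : ∃ p, 0 < w p := by
      by_contra! hcon
      have hw0 : w = fun _ => 0 := funext fun i => le_antisymm (hcon i) (hw i).1
      have : 0 < β ^ m * t := by positivity
      rw [hwt, hw0] at this
      simp [digitSum] at this
    have ht1 := one_add_gap_le_translation hβ0 h1 hβ hw hwm hwt hp
    have hcov := fun c (hc : IsDigitSeq N c) =>
      h.exists_add_or_sub hN hβ0 h1 hβ ht1 hw hwm hwt hc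
    have hpm : p < m := by
      by_contra hcon
      rw [hwm p (by omega)] at hp
      exact hp.false
    have hwp : w = Pi.single p (w p) := by
      funext q
      rcases eq_or_ne q p with rfl | hq
      · simp
      · rw [Pi.single_eq_of_ne hq]
        refine le_antisymm (not_lt.1 fun hcon => hq ?_) (hw q).1
        exact eq_of_pos_of_exists_add_or_sub hcov hcon hp
    have hwpN := hw p
    rw [Set.mem_Icc] at hwpN
    have hj : 2 * w p ≤ N + 1 := by
      by_contra hcon
      obtain ⟨k, hk⟩ := hcov (fun _ => w p - 1) fun _ => by
        dsimp only
        rw [Set.mem_Icc]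
        omega
      rcases hk with hk | hk <;>
      · have := (hk p hp).2
        omega
    have hcast : (((w p).toNat : ℕ) : ℝ) = (w p : ℝ) := by
      exact_mod_cast congrArg (Int.cast (R := ℝ)) (Int.toNat_of_nonneg hp.le)
    refine ⟨(w p).toNat, m - p, by omega, by omega, by omega, ?_⟩
    rw [hwp, digitSum_single] at hwt
    rw [hcast, zpow_neg, zpow_natCast]
    refine mul_left_cancel₀ (pow_pos hβ0 m).ne' ?_
    have hsplit : β ^ m = β ^ p * β ^ (m - p) := by
      rw [← pow_add]
      congr 1
      omega
    rw [hwt, hsplit]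
    field_simp
  · rintro ⟨j, k, -, hj, hk, rfl⟩
    refine isSelfSimilar_of_single_digit hβ0 h1 (j := j) (k := k) (by omega) hk ?_
    rw [zpow_neg, zpow_natCast]
    field_simp

end HSCantor
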